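/- Let K be an ω-stable structure and X a trivial strictly minimal set in K definable over a set A. Then no non-trivial equivalence relation on X is definable with parameters from K. (An equivalence relation on X is trivial if it is definable in the language of equality, i.e., has either a cofinite class or all but finitely many classes of size 1.) -/

import Mathlib

open FirstOrder

namespace TrivialMinimal

open FirstOrder.Language

variable {L : FirstOrder.Language} {M : Type*} [L.Structure M]

/-- A formula has the same truth value under valuations agreeing on its free variables. -/
theorem realize_congr {γ : Type*} [DecidableEq γ] (φ : L.Formula γ) {v w : γ → M}
    (h : ∀ i ∈ φ.freeVarFinset, v i = w i) : φ.Realize v ↔ φ.Realize w := by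
  have hv := BoundedFormula.realize_restrictFreeVar' (φ := φ) (s := ↑φ.freeVarFinset)
    (le_refl _) (v := v) (xs := default)
  have hw := BoundedFormula.realize_restrictFreeVar' (φ := φ) (s := ↑φ.freeVarFinset)
    (le_refl _) (v := w) (xs := default)
  have hvw : (v ∘ (↑) : ↥(φ.freeVarFinset : Set γ) → M) = w ∘ (↑) :=
    funext fun i => h i i.2
  rw [hvw] at hv
  exact hv.symm.trans hw

/-- If every free variable of `φ` is valued either at a coordinate of `x` or at a fixed element
of `B`, then the resulting set of `x` is definable over `B`. -/
theorem definable_of_realize {γ : Type*} [DecidableEq γ] {β : Type*} [Nonempty β] {B : Set M}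
    (φ : L.Formula γ) (u : (β → M) → γ → M)
    (hu : ∀ i ∈ φ.freeVarFinset, (∃ j, ∀ x, u x i = x j) ∨ ∃ c ∈ B, ∀ x, u x i = c) :
    B.Definable L {x | φ.Realize (u x)} := by
  classical
  have hr : ∀ i, ∃ t : B ⊕ β, i ∈ φ.freeVarFinset →
      ∀ x, u x i = Sum.elim (fun b : B => (b : M)) x t := by
    intro i
    by_cases hi : i ∈ φ.freeVarFinset
    · rcases hu i hi with ⟨j, hj⟩ | ⟨c, hc, hj⟩
      · exact ⟨.inr j, fun _ => hj⟩
      · exact ⟨.inl ⟨c, hc⟩, fun _ => hj⟩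
    · exact ⟨.inr (Classical.arbitrary β), fun h => absurd h hi⟩
  choose r hr using hr
  rw [Set.definable_iff_exists_formula_sum]
  refine ⟨φ.relabel r, ?_⟩
  ext x
  simp only [Set.mem_ofPred_eq, Formula.realize_relabel]
  exact realize_congr φ fun i hi => hr i hi x

variable (L) in
/-- Over `C`, algebraic closure is trivial on the definable set `X`: any finite set definable over
`C` and a finite subset `b` of `X` meets `X` inside `C ∪ b`. -/
structure TrivialOver (X C : Set M) : Prop where
  definable : C.Definable L {x : Fin 1 → M | x 0 ∈ X}
  finite_inter : (C ∩ X).Finite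
  subset_of_finite : ∀ b ⊆ X, b.Finite → ∀ s : Set M,
    (C ∪ b).Definable L {x : Fin 1 → M | x 0 ∈ s} → s.Finite → s ∩ X ⊆ C ∪ b

variable (L) in
/-- Every definable subset of `X` is finite or cofinite in `X`. -/
def IsMinimal (X : Set M) : Prop :=
  ∀ (B : Set M) (s : Set M), B.Definable L {x : Fin 1 → M | x 0 ∈ s} →
    (s ∩ X).Finite ∨ (X \ s).Finite

variable {X C : Set M}

/-- Truth does not change when one value outside the algebraic closure of the others moves. -/
theorem TrivialOver.realize_update (h : TrivialOver L X C) (hmin : IsMinimal L X)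
    {γ : Type*} [DecidableEq γ] (φ : L.Formula γ) (v : γ → M) (hv : ∀ i, v i ∈ C ∪ X) (a : γ)
    {x y : M} (hx : x ∈ X) (hy : y ∈ X) (hxC : x ∉ C) (hyC : y ∉ C)
    (hxv : ∀ i ∈ φ.freeVarFinset, i ≠ a → v i ≠ x)
    (hyv : ∀ i ∈ φ.freeVarFinset, i ≠ a → v i ≠ y) :
    φ.Realize (Function.update v a x) ↔ φ.Realize (Function.update v a y) := by
  set b : Set M := (v '' {i | i ∈ φ.freeVarFinset ∧ i ≠ a}) ∩ X with hb
  have hbfin : b.Finite :=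
    (((φ.freeVarFinset.finite_toSet).subset fun i hi => hi.1).image v).inter_of_left X
  have hbX : b ⊆ X := Set.inter_subset_right
  have hxb : x ∉ C ∪ b := by
    rintro (hc | ⟨⟨i, hi, rfl⟩, -⟩)
    exacts [hxC hc, hxv i hi.1 hi.2 rfl]
  have hyb : y ∉ C ∪ b := by
    rintro (hc | ⟨⟨i, hi, rfl⟩, -⟩)
    exacts [hyC hc, hyv i hi.1 hi.2 rfl]
  set s : Set M := {m | φ.Realize (Function.update v a m)} with hs
  have hsdef : (C ∪ b).Definable L {x : Fin 1 → M | x 0 ∈ s} := by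
    refine definable_of_realize φ (fun x => Function.update v a (x 0)) fun i hi => ?_
    by_cases hia : i = a
    · subst hia
      exact .inl ⟨0, fun x => by simp⟩
    · refine .inr ⟨v i, ?_, fun x => by simp [hia]⟩
      rcases hv i with hC | hX
      · exact .inl hC
      · exact .inr ⟨⟨i, ⟨hi, hia⟩, rfl⟩, hX⟩
  have hXdef := h.definable.mono (Set.subset_union_left (t := b))
  change x ∈ s ↔ y ∈ s
  rcases hmin _ s hsdef with hf | hf
  · have key := h.subset_of_finite b hbX hbfin (s ∩ X) (hsdef.inter hXdef) hf
    exact ⟨fun hxs => absurd (key ⟨⟨hxs, hx⟩, hx⟩) hxb,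
      fun hys => absurd (key ⟨⟨hys, hy⟩, hy⟩) hyb⟩
  · have key := h.subset_of_finite b hbX hbfin (X \ s) (hXdef.sdiff hsdef) hf
    have hxs : x ∈ s := by
      by_contra hxs
      exact hxb (key ⟨⟨hx, hxs⟩, hx⟩)
    have hys : y ∈ s := by
      by_contra hys
      exact hyb (key ⟨⟨hy, hys⟩, hy⟩)
    exact ⟨fun _ => hys, fun _ => hxs⟩

/-- Swapping two elements of `X` outside `C` is elementary on `C ∪ X`. -/
theorem TrivialOver.realize_swap (h : TrivialOver L X C) (hmin : IsMinimal L X)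
    (hinf : X.Infinite) [DecidableEq ↥(C ∪ X)] (φ : L.Formula ↥(C ∪ X)) {z w : ↥(C ∪ X)}
    (hz : (z : M) ∈ X) (hw : (w : M) ∈ X) (hzC : (z : M) ∉ C) (hwC : (w : M) ∉ C) :
    φ.Realize (fun i => (i : M)) ↔ φ.Realize (fun i => (Equiv.swap z w i : M)) := by
  classical
  by_cases hzw : z = w
  · subst hzw
    simp
  obtain ⟨t, ⟨htX, htC⟩, ht⟩ : ∃ t, t ∈ X \ (C ∩ X) ∧
      t ∉ insert (z : M) (insert (w : M) ((fun i : ↥(C ∪ X) => (i : M)) '' φ.freeVarFinset)) := by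
    have := (hinf.sdiff h.finite_inter).sdiff
      (((φ.freeVarFinset.finite_toSet.image fun i : ↥(C ∪ X) => (i : M)).insert (w : M)).insert
        (z : M))
    exact this.nonempty
  have htC : t ∉ C := fun hc => htC ⟨hc, htX⟩
  simp only [Set.mem_insert_iff, Set.mem_image, not_or, not_exists, not_and] at ht
  obtain ⟨htz, htw, htF⟩ := ht
  have hv0 : ∀ i : ↥(C ∪ X), (i : M) ∈ C ∪ X := fun i => i.2
  have hcoe : (fun i : ↥(C ∪ X) => (i : M)) =
      Function.update (fun i : ↥(C ∪ X) => (i : M)) z z := by simp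
  have hv1 : ∀ i : ↥(C ∪ X), Function.update (fun i : ↥(C ∪ X) => (i : M)) z t i ∈ C ∪ X := by
    intro i
    by_cases hi : i = z
    · subst hi; simp [htX]
    · simp [hi]
  have hv2 : ∀ i : ↥(C ∪ X), Function.update (Function.update
      (fun i : ↥(C ∪ X) => (i : M)) z t) w z i ∈ C ∪ X := by
    intro i
    by_cases hi : i = w
    · subst hi; simp
    · simpa only [Function.update_of_ne hi] using hv1 i
  have step1 : φ.Realize (fun i : ↥(C ∪ X) => (i : M)) ↔
      φ.Realize (Function.update (fun i : ↥(C ∪ X) => (i : M)) z t) := by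
    conv_lhs => rw [hcoe]
    exact h.realize_update hmin φ _ hv0 z hz htX hzC htC
      (fun i _ hi h => hi (Subtype.ext h)) (fun i hi _ => htF i hi)
  have step2 := h.realize_update hmin φ _ hv1 w hw hz hwC hzC
    (fun i _ hi => by
      by_cases hiz : i = z
      · subst hiz; simpa using htw
      · simpa [hiz] using fun h => hi (Subtype.ext h))
    (fun i _ hi => by
      by_cases hiz : i = z
      · subst hiz; simpa using htz
      · simpa [hiz] using fun h => hiz (Subtype.ext h))
  have step3 := h.realize_update hmin φ _ hv2 z htX hw htC hwC
    (fun i hi hiz => by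
      by_cases hiw : i = w
      · subst hiw; simpa using fun h : (z : M) = t => htz h.symm
      · simpa [hiz, hiw] using htF i hi)
    (fun i _ hiz => by
      by_cases hiw : i = w
      · subst hiw; simpa using fun h : (z : M) = i => hzw (Subtype.ext h)
      · simpa [hiz, hiw] using fun h => hiw (Subtype.ext h))
  have e2 : Function.update (Function.update (fun i : ↥(C ∪ X) => (i : M)) z t) w w =
      Function.update (fun i : ↥(C ∪ X) => (i : M)) z t := by
    rw [Function.update_eq_self_iff, Function.update_of_ne (Ne.symm hzw)]
  have e3 : Function.update (Function.update (Function.update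
      (fun i : ↥(C ∪ X) => (i : M)) z t) w z) z t =
      Function.update (Function.update (fun i : ↥(C ∪ X) => (i : M)) z t) w z := by
    rw [Function.update_eq_self_iff, Function.update_of_ne hzw, Function.update_self]
  have e4 : Function.update (Function.update (Function.update
      (fun i : ↥(C ∪ X) => (i : M)) z t) w z) z w = fun i => (Equiv.swap z w i : M) := by
    ext i
    by_cases hiz : i = z
    · subst hiz; simp
    · by_cases hiw : i = w
      · subst hiw; simp [hiz]
      · simp [hiz, hiw, Equiv.swap_apply_of_ne_of_ne]
  rw [e2] at step2
  rw [e3, e4] at step3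
  exact step1.trans (step2.trans step3)

/-- The formula `φ`, with parameters in `C ∪ X`, is satisfied by `d` after moving its parameters
by a permutation that fixes `C` and is elementary. -/
def IsConjugateTo (d : M) (φ : L.Formula (↥(C ∪ X) ⊕ Unit)) : Prop :=
  ∃ g : Equiv.Perm ↥(C ∪ X), (∀ c : ↥(C ∪ X), (c : M) ∈ C → g c = c) ∧
    (∀ χ : L.Formula ↥(C ∪ X),
      χ.Realize (fun i => (i : M)) ↔ χ.Realize (fun i => (g i : M))) ∧
    φ.Realize (Sum.elim (fun i => (g i : M)) fun _ => d)

theorem IsConjugateTo.exists_realize {d : M} {φ : L.Formula (↥(C ∪ X) ⊕ Unit)}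
    (h : IsConjugateTo d φ) :
    ∃ y : M, φ.Realize (Sum.elim (fun i => (i : M)) fun _ => y) := by
  obtain ⟨g, -, hg, hd⟩ := h
  have := (hg (φ.iExs Unit)).2 (by
    rw [Formula.realize_iExs]
    exact ⟨fun _ => d, hd⟩)
  rw [Formula.realize_iExs] at this
  obtain ⟨i, hi⟩ := this
  exact ⟨i (), hi⟩

/-- If triviality over `C ∪ {d}` fails beyond every finite subset of `X`, each conjugate condition
on `d` splits into two contradictory ones. -/
theorem IsConjugateTo.split (h : TrivialOver L X C) (hmin : IsMinimal L X) (hinf : X.Infinite)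
    {d : M}
    (hd : ∀ B ⊆ X, B.Finite → ∃ b ⊆ X, B ⊆ b ∧ b.Finite ∧ ∃ s : Set M,
      (insert d (C ∪ b)).Definable L {x : Fin 1 → M | x 0 ∈ s} ∧ s.Finite ∧
      ∃ z ∈ s, z ∈ X ∧ z ∉ C ∪ b)
    {φ : L.Formula (↥(C ∪ X) ⊕ Unit)} (hφ : IsConjugateTo d φ) :
    ∃ ψ : L.Formula (↥(C ∪ X) ⊕ Unit),
      IsConjugateTo d (φ ⊓ ψ) ∧ IsConjugateTo d (φ ⊓ ψ.not) := by
  classical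
  obtain ⟨g, hgC, hg, hgd⟩ := hφ
  obtain ⟨b, hbX, hBb, hbfin, s, hsdef, hsfin, z, hzs, hzX, hzb⟩ :=
    hd (((fun i : ↥(C ∪ X) ⊕ Unit => Sum.elim (fun i => (g i : M)) (fun _ => d) i) ''
      φ.freeVarFinset) ∩ X) Set.inter_subset_right
      ((φ.freeVarFinset.finite_toSet.image _).inter_of_left X)
  obtain ⟨w, ⟨hwX, hwC⟩, hw⟩ : ∃ w, w ∈ X \ (C ∩ X) ∧ w ∉ b ∪ s :=
    ((hinf.sdiff h.finite_inter).sdiff (hbfin.union hsfin)).nonempty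
  have hwC : w ∉ C := fun hc => hwC ⟨hc, hwX⟩
  have hwb : w ∉ b := fun hb => hw (.inl hb)
  have hws : w ∉ s := fun hb => hw (.inr hb)
  have hzC : z ∉ C := fun hc => hzb (.inl hc)
  have hzb' : z ∉ b := fun hc => hzb (.inr hc)
  rw [Set.definable_iff_exists_formula_sum] at hsdef
  obtain ⟨ψ, hψ⟩ := hsdef
  have hsub : C ∪ b ⊆ C ∪ X := Set.union_subset_union_right C hbX
  let z' : ↥(C ∪ X) := ⟨z, .inr hzX⟩
  let w' : ↥(C ∪ X) := ⟨w, .inr hwX⟩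
  let r : ↥(insert d (C ∪ b)) ⊕ Fin 1 → ↥(C ∪ X) ⊕ Unit := Sum.elim
    (fun p => if hp : (p : M) ∈ C ∪ b then .inl (g.symm ⟨p, hsub hp⟩) else .inr ())
    (fun _ => .inl (g.symm z'))
  have hval : ∀ k : Equiv.Perm ↥(C ∪ X), (∀ p : ↥(C ∪ X), (p : M) ∈ C ∪ b → k p = p) →
      ((ψ.relabel r).Realize (Sum.elim (fun i => ((g.trans k) i : M)) fun _ => d) ↔
        (k z' : M) ∈ s) := by
    intro k hk
    have : ((k z' : ↥(C ∪ X)) : M) ∈ s ↔ (fun _ : Fin 1 => ((k z' : ↥(C ∪ X)) : M)) ∈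
        {x : Fin 1 → M | x 0 ∈ s} := Iff.rfl
    rw [this, hψ, Set.mem_ofPred_eq, Formula.realize_relabel]
    refine iff_of_eq (congrArg _ (funext fun i => ?_))
    rcases i with ⟨p, hp⟩ | i
    · by_cases hpC : p ∈ C ∪ b
      · have hr : r (.inl ⟨p, hp⟩) = .inl (g.symm ⟨p, hsub hpC⟩) := dif_pos hpC
        simp [hr, hk ⟨p, hsub hpC⟩ hpC]
      · have hpd : p = d := by
          rcases hp with hp | hp
          exacts [hp, absurd hp hpC]
        have hr : r (.inl ⟨p, hp⟩) = .inr () := dif_neg hpC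
        simp [hr, ← hpd]
    · simp [r]
  refine ⟨ψ.relabel r, ⟨g, hgC, hg, ?_⟩, ⟨g.trans (Equiv.swap z' w'), ?_, ?_, ?_⟩⟩
  · rw [Formula.realize_inf]
    exact ⟨hgd, (hval 1 fun _ _ => rfl).2 hzs⟩
  · intro c hc
    rw [Equiv.trans_apply, hgC c hc]
    refine Equiv.swap_apply_of_ne_of_ne ?_ ?_
    · rintro rfl; exact hzC hc
    · rintro rfl; exact hwC hc
  · intro χ
    rw [hg χ]
    have := h.realize_swap hmin hinf (χ.relabel g) (z := z') (w := w') hzX hwX hzC hwC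
    rw [Formula.realize_relabel, Formula.realize_relabel] at this
    exact this
  · rw [Formula.realize_inf, Formula.realize_not]
    constructor
    · refine (realize_congr φ fun i hi => ?_).1 hgd
      rcases i with i | i
      · have hgX : (g i : M) ∈ X → (g i : M) ∈ b := fun hX => hBb ⟨⟨.inl i, hi, rfl⟩, hX⟩
        have : Equiv.swap z' w' (g i) = g i := by
          refine Equiv.swap_apply_of_ne_of_ne ?_ ?_
          · intro e
            rw [e] at hgX
            exact hzb' (hgX hzX)
          · intro e
            rw [e] at hgX
            exact hwb (hgX hwX)
        simp [this]
      · rfl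
    · rw [hval]
      · simpa [w'] using hws
      · intro p hp
        refine Equiv.swap_apply_of_ne_of_ne ?_ ?_
        · rintro rfl; exact hzb hp
        · rintro rfl
          exact hp.elim hwC hwb

variable (L M) in
/-- There is no binary tree of nonempty definable subsets of `M`. -/
def NoBinaryTree : Prop :=
  ¬ ∃ S : List Bool → Set M,
    (∀ σ, ∃ P : Set M, Set.Definable P L {x : Fin 1 → M | x 0 ∈ S σ}) ∧
    (∀ σ b, S (σ ++ [b]) ⊆ S σ) ∧
    (∀ σ, S (σ ++ [true]) ∩ S (σ ++ [false]) = ∅) ∧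
    (∀ σ, (S σ).Nonempty)

/-- Without binary trees, triviality survives naming one more element `d`, after also naming
finitely many elements of `X`. -/
theorem TrivialOver.exists_insert (h : TrivialOver L X C) (hmin : IsMinimal L X)
    (hinf : X.Infinite) (hstable : NoBinaryTree L M) (d : M) :
    ∃ C' : Set M, C ⊆ C' ∧ d ∈ C' ∧ TrivialOver L X C' := by
  classical
  by_cases hd : ∀ B ⊆ X, B.Finite → ∃ b ⊆ X, B ⊆ b ∧ b.Finite ∧ ∃ s : Set M,
      (insert d (C ∪ b)).Definable L {x : Fin 1 → M | x 0 ∈ s} ∧ s.Finite ∧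
      ∃ z ∈ s, z ∈ X ∧ z ∉ C ∪ b
  · exfalso
    choose split hsplit using fun φ : {φ : L.Formula (↥(C ∪ X) ⊕ Unit) // IsConjugateTo d φ} =>
      IsConjugateTo.split h hmin hinf hd φ.2
    let child (φ : {φ : L.Formula (↥(C ∪ X) ⊕ Unit) // IsConjugateTo d φ}) (b : Bool) :
        {φ : L.Formula (↥(C ∪ X) ⊕ Unit) // IsConjugateTo d φ} :=
      if b then ⟨_, (hsplit φ).1⟩ else ⟨_, (hsplit φ).2⟩
    let root : {φ : L.Formula (↥(C ∪ X) ⊕ Unit) // IsConjugateTo d φ} :=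
      ⟨⊤, 1, fun _ _ => rfl, fun _ => Iff.rfl, by simp⟩
    refine hstable ⟨fun σ => {y | (σ.foldl child root).1.Realize
      (Sum.elim (fun i => (i : M)) fun _ => y)}, ?_, ?_, ?_, ?_⟩
    · intro σ
      refine ⟨C ∪ X, definable_of_realize (σ.foldl child root).1
        (fun x => Sum.elim (fun i => (i : M)) fun _ => x 0) ?_⟩
      rintro (i | i) -
      · exact .inr ⟨i, i.2, fun _ => rfl⟩
      · exact .inl ⟨0, fun _ => rfl⟩
    · intro σ b y hy
      rw [Set.mem_ofPred_eq, List.foldl_append] at hy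
      cases b
      all_goals
        simp only [List.foldl_cons, List.foldl_nil, child, if_true, Bool.false_eq_true, if_false,
          Formula.realize_inf] at hy
        exact hy.1
    · intro σ
      ext y
      simp only [List.foldl_append, List.foldl_cons, List.foldl_nil, child, if_true,
        Bool.false_eq_true, if_false, Formula.realize_inf, Formula.realize_not,
        Set.mem_inter_iff, Set.mem_ofPred_eq, Set.mem_empty_iff_false, iff_false]
      exact fun hy => hy.2.2 hy.1.2
    · exact fun σ => (σ.foldl child root).2.exists_realize
  · push Not at hd
    obtain ⟨B, hBX, hBfin, hB⟩ := hd
    refine ⟨insert d (C ∪ B), fun c hc => .inr (.inl hc), .inl rfl,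
      h.definable.mono fun c hc => .inr (.inl hc), ?_, ?_⟩
    · refine ((h.finite_inter.union hBfin).insert d).subset ?_
      rintro c ⟨rfl | hc | hc, hX⟩
      exacts [.inl rfl, .inr (.inl ⟨hc, hX⟩), .inr (.inr hc)]
    · rintro b hbX hbfin s hs hsfin z ⟨hzs, hzX⟩
      rw [Set.insert_union, Set.union_assoc] at hs ⊢
      exact .inr (hB (B ∪ b) (Set.union_subset hBX hbX) Set.subset_union_left
        (hBfin.union hbfin) s hs hsfin z hzs hzX)

theorem TrivialOver.exists_union_finset (h : TrivialOver L X C) (hmin : IsMinimal L X)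
    (hinf : X.Infinite) (hstable : NoBinaryTree L M) (F : Finset M) :
    ∃ C' : Set M, C ⊆ C' ∧ (F : Set M) ⊆ C' ∧ TrivialOver L X C' := by
  classical
  induction F using Finset.induction_on with
  | empty => exact ⟨C, subset_rfl, by simp, h⟩
  | insert d F _ ih =>
    obtain ⟨C₁, hC₁, hF, h₁⟩ := ih
    obtain ⟨C₂, hC₂, hd, h₂⟩ := h₁.exists_insert hmin hinf hstable d
    refine ⟨C₂, hC₁.trans hC₂, ?_, h₂⟩
    rw [Finset.coe_insert]
    exact Set.insert_subset hd (hF.trans hC₂)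

/-- The fibers of a binary definable relation are definable. -/
theorem definable_fiber {E : Set (M × M)}
    (hE : C.Definable L {x : Fin 2 → M | (x 0, x 1) ∈ E}) (a : M) :
    (C ∪ {a}).Definable L {x : Fin 1 → M | x 0 ∈ {y | (a, y) ∈ E}} := by
  classical
  rw [Set.definable_iff_exists_formula_sum] at hE
  obtain ⟨ψ, hψ⟩ := hE
  have : {x : Fin 1 → M | x 0 ∈ {y | (a, y) ∈ E}} =
      {x | ψ.Realize (Sum.elim (fun i : C => (i : M)) ![a, x 0])} := by
    ext x
    have := Set.ext_iff.1 hψ ![a, x 0]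
    simpa using this
  rw [this]
  refine definable_of_realize ψ _ ?_
  rintro (i | i) -
  · exact .inr ⟨i, .inl i.2, fun _ => rfl⟩
  · fin_cases i
    · exact .inr ⟨a, .inr rfl, fun _ => rfl⟩
    · exact .inl ⟨0, fun _ => rfl⟩

end TrivialMinimal

/-- in an ω-stable structure M, if X is a trivial strictly
minimal set definable over A, then no non-trivial equivalence relation on X is
definable with parameters from M; i.e. every definable equivalence relation on
X either has all but finitely many of its classes of size 1, or has a cofinite
class.  Here: `acl` is the algebraic closure operator (characterized by
`hacl`); ω-stability is taken in its totally transcendental form (`hstable`: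
no binary tree of nonempty definable sets); X is strongly minimal (`hsm`),
infinite, strictly minimal over A (`hdisj`, `hstrict`), and has trivial
geometry (`htriv`). -/
theorem no_nontrivial_definable_equivalence_relation
    {L : FirstOrder.Language} {M : Type*} [L.Structure M]
    (acl : Set M → Set M)
    (hacl : ∀ (B : Set M) (a : M),
      a ∈ acl B ↔ ∃ s : Set M,
        Set.Definable B L {x : Fin 1 → M | x 0 ∈ s} ∧ s.Finite ∧ a ∈ s)
    (hstable : ¬ ∃ S : List Bool → Set M,
        (∀ σ, ∃ P : Set M, Set.Definable P L {x : Fin 1 → M | x 0 ∈ S σ}) ∧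
        (∀ σ b, S (σ ++ [b]) ⊆ S σ) ∧
        (∀ σ, S (σ ++ [true]) ∩ S (σ ++ [false]) = ∅) ∧
        (∀ σ, (S σ).Nonempty))
    (A X : Set M)
    (hXdef : Set.Definable A L {x : Fin 1 → M | x 0 ∈ X})
    (hsm : ∀ (B : Set M) (s : Set M),
      Set.Definable B L {x : Fin 1 → M | x 0 ∈ s} →
        (s ∩ X).Finite ∨ (X \ s).Finite)
    (hXinf : X.Infinite)
    (hdisj : X ∩ acl A = ∅)
    (hstrict : ∀ a ∈ X, acl (A ∪ {a}) ∩ X = {a})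
    (htriv : ∀ B ⊆ X, acl (A ∪ B) ∩ X = (⋃ b ∈ B, acl (A ∪ {b})) ∩ X)
    (E : Set (M × M))
    (hEdef : ∃ P : Set M, Set.Definable P L {x : Fin 2 → M | (x 0, x 1) ∈ E})
    (hrefl : ∀ x ∈ X, (x, x) ∈ E)
    (hsymm : ∀ x ∈ X, ∀ y ∈ X, (x, y) ∈ E → (y, x) ∈ E)
    (htrans : ∀ x ∈ X, ∀ y ∈ X, ∀ z ∈ X,
      (x, y) ∈ E → (y, z) ∈ E → (x, z) ∈ E) :
    {x ∈ X | ∃ y ∈ X, y ≠ x ∧ (x, y) ∈ E}.Finite ∨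
    ∃ x ∈ X, (X \ {y ∈ X | (x, y) ∈ E}).Finite := by
  classical
  have hA : TrivialMinimal.TrivialOver L X A := by
    have hAX : A ∩ X = ∅ := by
      rw [Set.eq_empty_iff_forall_notMem]
      rintro a ⟨haA, haX⟩
      refine Set.eq_empty_iff_forall_notMem.1 hdisj a ⟨haX, (hacl A a).2 ⟨{a}, ?_, by simp, rfl⟩⟩
      have := TrivialMinimal.definable_of_realize (B := A) (β := Fin 1)
        (Language.Term.equal (L := L) (Language.var (0 : Fin 2)) (Language.var 1))
        (fun x => ![x 0, a]) (fun i _ => by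
          fin_cases i
          · exact .inl ⟨0, fun _ => rfl⟩
          · exact .inr ⟨a, haA, fun _ => rfl⟩)
      simpa [Language.Formula.realize_equal] using this
    refine ⟨hXdef, by simp [hAX], ?_⟩
    rintro b hbX - s hs hsfin z ⟨hzs, hzX⟩
    have hz : z ∈ acl (A ∪ b) ∩ X := ⟨(hacl _ z).2 ⟨s, hs, hsfin, hzs⟩, hzX⟩
    rw [htriv b hbX] at hz
    obtain ⟨c, hcb, hzc⟩ := Set.mem_iUnion₂.1 hz.1
    have : z ∈ ({c} : Set M) := hstrict c (hbX hcb) ▸ ⟨hzc, hzX⟩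
    rw [Set.mem_singleton_iff.1 this]
    exact .inr hcb
  obtain ⟨P, hP⟩ := hEdef
  obtain ⟨F, -, hF⟩ := Set.definable_iff_finitely_definable.1 hP
  obtain ⟨C, -, hFC, hC⟩ := hA.exists_union_finset hsm hXinf hstable F
  have hE := hF.mono hFC
  by_cases hcof : ∃ x ∈ X, (X \ {y ∈ X | (x, y) ∈ E}).Finite
  · exact .inr hcof
  left
  push Not at hcof
  have hdef : ∀ x, (C ∪ {x}).Definable L {v : Fin 1 → M | v 0 ∈ {y ∈ X | (x, y) ∈ E}} :=
    fun x => (hC.definable.mono Set.subset_union_left).inter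
      (TrivialMinimal.definable_fiber hE x)
  have hfin : ∀ x ∈ X, {y ∈ X | (x, y) ∈ E}.Finite := by
    intro x hx
    rcases hsm _ _ (hdef x) with h | h
    · exact h.subset fun y hy => ⟨hy, hy.1⟩
    · exact absurd h (hcof x hx)
  refine (hC.finite_inter.union
    (hC.finite_inter.biUnion fun y hy => hfin y hy.2)).subset ?_
  rintro x ⟨hx, y, hy, hyx, hxy⟩
  rcases hC.subset_of_finite {x} (by simpa using hx) (Set.finite_singleton x) _ (hdef x)
    (hfin x hx) ⟨⟨hy, hxy⟩, hy⟩ with hyC | hyx'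
  · exact .inr (Set.mem_iUnion₂.2 ⟨y, ⟨hyC, hy⟩, hx, hsymm x hx y hy hxy⟩)
  · exact absurd hyx' hyx
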